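/- Let S⁰ be an adequate semigroup with semilattice of idempotents E⁰, L a left adequate semigroup and R a right adequate semigroup such that S⁰ is a quasi-ideal adequate transversal of both L and R, and let ∗ : R × L → S⁰ satisfy conditions (1), (2) and additionally (3): e∗f ∈ E⁰ for all e ∈ E(R) and f ∈ E(L). Then T = {(x,a) ∈ L × R : x̄ = ā} with multiplication (x,a)(y,b) = (e_x(a∗y), (a∗y)f_b) is an abundant semigroup and T⁰ = {(s,s) : s ∈ S⁰} is a multiplicative adequate transversal of T isomorphic to S⁰. Conversely, if S⁰ is a multiplicative adequate transversal of an abundant semigroup S, then with a∗x = ax (a ∈ R(S), x ∈ L(S)) conditions (1)–(3) hold and S is isomorphic to the resulting semigroup T. -/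

import Mathlib

/-!
Common framework: "relative" semigroup-theoretic notions.  All notions are taken
relative to a carrier set `U` inside an ambient type, together with an explicit
binary operation `mul` (only the values of `mul` on `U` are relevant).  For an
honest semigroup `S` one takes `U = Set.univ` and `mul = mulOf S`.

* `RStarOn mul U a b` : the relation `a ℛ* b` computed in `U` with an identity
  adjoined (the two clauses correspond to multipliers from `U` and to the
  adjoined identity).
* `LStarOn`, `GreenLOn`, `GreenROn` : dual / Green's relations.
* `AbundantOn`, `AdequateOn`, `LeftAdequateOn`, `RightAdequateOn`.
* `AdequateTransversalOn mul U S0` : `S0` is an adequate `*`-subsemigroup of `U`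
  which is an adequate transversal, with the data `bar x = x̄`, `e x = e_x`,
  `f x = f_x`, and `plus s = s⁺`, `star s = s⋆` for `s ∈ S0`.
* `InverseTransversalOn mul U S0` : `S0` is an inverse transversal of the
  regular semigroup `U`, with `o x = x⁰` the unique inverse of `x` in `S0`.
-/

namespace Paper

universe u

variable {α : Type*} {β : Type*} {γ : Type*}

def mulOf (α : Type*) [Mul α] : α → α → α := fun a b => a * b

/-- `x` is an idempotent for the operation `mul`. -/
def Idem (mul : α → α → α) (x : α) : Prop := mul x x = x

/-- The relation `ℛ*` on `U` (with an identity adjoined to `U`). -/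
def RStarOn (mul : α → α → α) (U : Set α) (a b : α) : Prop :=
  (∀ x ∈ U, ∀ y ∈ U, (mul x a = mul y a ↔ mul x b = mul y b)) ∧
  (∀ x ∈ U, (mul x a = a ↔ mul x b = b))

/-- The relation `ℒ*` on `U` (with an identity adjoined to `U`). -/
def LStarOn (mul : α → α → α) (U : Set α) (a b : α) : Prop :=
  (∀ x ∈ U, ∀ y ∈ U, (mul a x = mul a y ↔ mul b x = mul b y)) ∧
  (∀ x ∈ U, (mul a x = a ↔ mul b x = b))

/-- Green's relation `ℒ` on `U`: `U¹ a = U¹ b`. -/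
def GreenLOn (mul : α → α → α) (U : Set α) (a b : α) : Prop :=
  (a = b ∨ ∃ u ∈ U, mul u b = a) ∧ (b = a ∨ ∃ v ∈ U, mul v a = b)

/-- Green's relation `ℛ` on `U`: `a U¹ = b U¹`. -/
def GreenROn (mul : α → α → α) (U : Set α) (a b : α) : Prop :=
  (a = b ∨ ∃ u ∈ U, mul b u = a) ∧ (b = a ∨ ∃ v ∈ U, mul a v = b)

/-- `U` is closed under `mul`. -/
def ClosedOn (mul : α → α → α) (U : Set α) : Prop :=
  ∀ a ∈ U, ∀ b ∈ U, mul a b ∈ U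

/-- `U` with the operation `mul` is a semigroup. -/
def SemigroupOn (mul : α → α → α) (U : Set α) : Prop :=
  ClosedOn mul U ∧ ∀ a ∈ U, ∀ b ∈ U, ∀ c ∈ U, mul (mul a b) c = mul a (mul b c)

/-- Every `ℛ*`-class and every `ℒ*`-class of `U` contains an idempotent. -/
def AbundantOn (mul : α → α → α) (U : Set α) : Prop :=
  ∀ a ∈ U, (∃ e ∈ U, Idem mul e ∧ RStarOn mul U a e) ∧
           (∃ f ∈ U, Idem mul f ∧ LStarOn mul U a f)

/-- Abundant with commuting idempotents. -/
def AdequateOn (mul : α → α → α) (U : Set α) : Prop :=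
  AbundantOn mul U ∧
    ∀ u ∈ U, ∀ v ∈ U, Idem mul u → Idem mul v → mul u v = mul v u

/-- Abundant, and every `ℛ*`-class contains a unique idempotent. -/
def LeftAdequateOn (mul : α → α → α) (U : Set α) : Prop :=
  AbundantOn mul U ∧
    ∀ u ∈ U, ∀ v ∈ U, Idem mul u → Idem mul v → RStarOn mul U u v → u = v

/-- Abundant, and every `ℒ*`-class contains a unique idempotent. -/
def RightAdequateOn (mul : α → α → α) (U : Set α) : Prop :=
  AbundantOn mul U ∧
    ∀ u ∈ U, ∀ v ∈ U, Idem mul u → Idem mul v → LStarOn mul U u v → u = v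

/-- `S0` is a quasi-ideal of `U` : `S0 U S0 ⊆ S0`. -/
def QuasiIdealOn (mul : α → α → α) (U S0 : Set α) : Prop :=
  ∀ s ∈ S0, ∀ x ∈ U, ∀ t ∈ S0, mul (mul s x) t ∈ S0

/-- Every element of `U` has an inverse in `U`. -/
def RegularOn (mul : α → α → α) (U : Set α) : Prop :=
  ∀ x ∈ U, ∃ u ∈ U, mul (mul x u) x = x ∧ mul (mul u x) u = u

/-- Regular with commuting idempotents, i.e. an inverse semigroup. -/
def InverseSgpOn (mul : α → α → α) (U : Set α) : Prop :=
  RegularOn mul U ∧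
    ∀ u ∈ U, ∀ v ∈ U, Idem mul u → Idem mul v → mul u v = mul v u

/-- Regular, and every Green `ℛ`-class contains a unique idempotent. -/
def LeftInverseSgpOn (mul : α → α → α) (U : Set α) : Prop :=
  RegularOn mul U ∧
    ∀ u ∈ U, ∀ v ∈ U, Idem mul u → Idem mul v → GreenROn mul U u v → u = v

/-- Regular, and every Green `ℒ`-class contains a unique idempotent. -/
def RightInverseSgpOn (mul : α → α → α) (U : Set α) : Prop :=
  RegularOn mul U ∧
    ∀ u ∈ U, ∀ v ∈ U, Idem mul u → Idem mul v → GreenLOn mul U u v → u = v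

/-- An isomorphism from `(A, mulA)` onto `(B, mulB)`. -/
def IsoOn (mulA : α → α → α) (mulB : β → β → β) (A : Set α) (B : Set β) : Prop :=
  ∃ θ : α → β, Set.BijOn θ A B ∧ ∀ a ∈ A, ∀ b ∈ A, θ (mulA a b) = mulB (θ a) (θ b)

/-- `S0` is an adequate transversal of the abundant semigroup `U`.  `S0` is an
adequate `*`-subsemigroup of `U` (witnessed by `plus`/`star`, the canonical
idempotents `a⁺ ℛ* a`, `a⋆ ℒ* a` of elements of `S0`, the `ℛ*`/`ℒ*` relations
being those of the big semigroup `U`, which gives the `*`-subsemigroup property),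
and every `x ∈ U` factors uniquely as `x = e_x x̄ f_x` with `x̄ ∈ S0`,
`e_x, f_x` idempotents of `U`, `e_x ℒ x̄⁺` and `f_x ℛ x̄⋆`. -/
structure AdequateTransversalOn (mul : α → α → α) (U S0 : Set α) where
  sub : S0 ⊆ U
  mul_mem : ∀ a ∈ S0, ∀ b ∈ S0, mul a b ∈ S0
  bar : α → α
  e : α → α
  f : α → α
  plus : α → α
  star : α → α
  plus_mem : ∀ a ∈ S0, plus a ∈ S0
  plus_idem : ∀ a ∈ S0, Idem mul (plus a)
  plus_rstar : ∀ a ∈ S0, RStarOn mul U a (plus a)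
  star_mem : ∀ a ∈ S0, star a ∈ S0
  star_idem : ∀ a ∈ S0, Idem mul (star a)
  star_lstar : ∀ a ∈ S0, LStarOn mul U a (star a)
  idem_comm : ∀ u ∈ S0, ∀ v ∈ S0, Idem mul u → Idem mul v → mul u v = mul v u
  bar_mem : ∀ x ∈ U, bar x ∈ S0
  e_mem : ∀ x ∈ U, e x ∈ U
  f_mem : ∀ x ∈ U, f x ∈ U
  e_idem : ∀ x ∈ U, Idem mul (e x)
  f_idem : ∀ x ∈ U, Idem mul (f x)
  decomp : ∀ x ∈ U, x = mul (mul (e x) (bar x)) (f x)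
  e_greenL : ∀ x ∈ U, GreenLOn mul U (e x) (plus (bar x))
  f_greenR : ∀ x ∈ U, GreenROn mul U (f x) (star (bar x))
  unique : ∀ x ∈ U, ∀ s ∈ S0, ∀ e' ∈ U, ∀ f' ∈ U, Idem mul e' → Idem mul f' →
      x = mul (mul e' s) f' → GreenLOn mul U e' (plus s) → GreenROn mul U f' (star s) →
      s = bar x ∧ e' = e x ∧ f' = f x

namespace AdequateTransversalOn

variable {mul : α → α → α} {U S0 : Set α}

/-- `R = {x ∈ U : e_x = e_{x̄}}`. -/
def Rset (T : AdequateTransversalOn mul U S0) : Set α :=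
  {x | x ∈ U ∧ T.e x = T.e (T.bar x)}

/-- `L = {x ∈ U : f_x = f_{x̄}}`. -/
def Lset (T : AdequateTransversalOn mul U S0) : Set α :=
  {x | x ∈ U ∧ T.f x = T.f (T.bar x)}

/-- `I = {e_x : x ∈ U}`. -/
def Iset (T : AdequateTransversalOn mul U S0) : Set α :=
  {y | ∃ x ∈ U, T.e x = y}

/-- `Λ = {f_x : x ∈ U}`. -/
def LamSet (T : AdequateTransversalOn mul U S0) : Set α :=
  {y | ∃ x ∈ U, T.f x = y}

/-- The transversal is multiplicative: `Λ I ⊆ E⁰`. -/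
def IsMultiplicative (T : AdequateTransversalOn mul U S0) : Prop :=
  ∀ l ∈ T.LamSet, ∀ i ∈ T.Iset, mul l i ∈ S0 ∧ Idem mul (mul l i)

end AdequateTransversalOn

/-- The spined product set `T = L |×| R ⊆ S × S` attached to an adequate
transversal of `S` (ambient carrier `U`). -/
def spSet {mul : α → α → α} {U S0 : Set α}
    (T : AdequateTransversalOn mul U S0) : Set (α × α) :=
  {p | p.1 ∈ T.Lset ∧ p.2 ∈ T.Rset ∧ T.bar p.1 = T.bar p.2}

/-- The multiplication `(x,a)(y,b) = (e_x(ay), (ay) f_b)` on the spined product. -/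
def spMul {mul : α → α → α} {U S0 : Set α}
    (T : AdequateTransversalOn mul U S0) : α × α → α × α → α × α :=
  fun p q => (mul (T.e p.1) (mul p.2 q.1), mul (mul p.2 q.1) (T.f q.2))

/-- The map `φ : S → T`, `x ↦ (e_x x̄, x̄ f_x)`. -/
def phiMap {mul : α → α → α} {U S0 : Set α}
    (T : AdequateTransversalOn mul U S0) : α → α × α :=
  fun x => (mul (T.e x) (T.bar x), mul (T.bar x) (T.f x))

/-- `T⁰ = {(s,s) : s ∈ S0}`. -/
def diagSet (S0 : Set α) : Set (α × α) := {p | ∃ s ∈ S0, p = (s, s)}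

/-- Abstract spined product `L |×| R` over a common transversal `S⁰` (a type `γ`
embedded into `L` and `R` by `jL`, `jR`). -/
def absTset {mulL : α → α → α} {mulR : β → β → β} {jL : γ → α} {jR : γ → β}
    (TL : AdequateTransversalOn mulL Set.univ (Set.range jL))
    (TR : AdequateTransversalOn mulR Set.univ (Set.range jR)) : Set (α × β) :=
  {p | ∃ s : γ, jL s = TL.bar p.1 ∧ jR s = TR.bar p.2}

/-- The multiplication `(x,a)(y,b) = (e_x(a∗y), (a∗y) f_b)`. -/
def absMul {mulL : α → α → α} {mulR : β → β → β} {jL : γ → α} {jR : γ → β}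
    (TL : AdequateTransversalOn mulL Set.univ (Set.range jL))
    (TR : AdequateTransversalOn mulR Set.univ (Set.range jR))
    (st : β → α → γ) : α × β → α × β → α × β :=
  fun p q => (mulL (TL.e p.1) (jL (st p.2 q.1)), mulR (jR (st p.2 q.1)) (TR.f q.2))

/-- `T⁰ = {(s,s) : s ∈ S⁰}` inside `L × R`, where `s` is viewed in `L` and in `R`. -/
def absT0 (jL : γ → α) (jR : γ → β) : Set (α × β) :=
  {p | ∃ s : γ, p = (jL s, jR s)}

/-- `S0` is an inverse transversal of the regular semigroup `U`: an inverse
subsemigroup meeting the set of inverses of each `x ∈ U` in exactly one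
element `o x = x⁰`. -/
structure InverseTransversalOn (mul : α → α → α) (U S0 : Set α) where
  sub : S0 ⊆ U
  mul_mem : ∀ a ∈ S0, ∀ b ∈ S0, mul a b ∈ S0
  o : α → α
  o_mem : ∀ x ∈ U, o x ∈ S0
  o_inv1 : ∀ x ∈ U, mul (mul x (o x)) x = x
  o_inv2 : ∀ x ∈ U, mul (mul (o x) x) (o x) = o x
  o_unique : ∀ x ∈ U, ∀ u ∈ S0, mul (mul x u) x = x → mul (mul u x) u = u → u = o x
  idem_comm : ∀ u ∈ S0, ∀ v ∈ S0, Idem mul u → Idem mul v → mul u v = mul v u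

namespace InverseTransversalOn

variable {mul : α → α → α} {U S0 : Set α}

/-- `L = {x ∈ U : x⁰x ∈ E⁰}`. -/
def LsetI (T : InverseTransversalOn mul U S0) : Set α :=
  {x | x ∈ U ∧ mul (T.o x) x ∈ S0 ∧ Idem mul (mul (T.o x) x)}

/-- `R = {x ∈ U : xx⁰ ∈ E⁰}`. -/
def RsetI (T : InverseTransversalOn mul U S0) : Set α :=
  {x | x ∈ U ∧ mul x (T.o x) ∈ S0 ∧ Idem mul (mul x (T.o x))}

end InverseTransversalOn

/-- Spined product set for an inverse transversal: `{(x,a) : x⁰ = a⁰}`. -/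
def invSpSet {mul : α → α → α} {U S0 : Set α}
    (T : InverseTransversalOn mul U S0) : Set (α × α) :=
  {p | p.1 ∈ T.LsetI ∧ p.2 ∈ T.RsetI ∧ T.o p.1 = T.o p.2}

/-- The multiplication `(x,a)(y,b) = ((xx⁰)(ay), (ay)(b⁰b))`. -/
def invSpMul {mul : α → α → α} {U S0 : Set α}
    (T : InverseTransversalOn mul U S0) : α × α → α × α → α × α :=
  fun p q => (mul (mul p.1 (T.o p.1)) (mul p.2 q.1),
              mul (mul p.2 q.1) (mul (T.o q.2) q.2))

/-- Abstract spined product for inverse transversals: `{(x,a) : x⁰ = a⁰}`. -/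
def invAbsTset {mulL : α → α → α} {mulR : β → β → β} {jL : γ → α} {jR : γ → β}
    (TL : InverseTransversalOn mulL Set.univ (Set.range jL))
    (TR : InverseTransversalOn mulR Set.univ (Set.range jR)) : Set (α × β) :=
  {p | ∃ s : γ, jL s = TL.o p.1 ∧ jR s = TR.o p.2}

/-- The multiplication `(x,a)(y,b) = ((xx⁰)(a∗y), (a∗y)(b⁰b))`. -/
def invAbsMul {mulL : α → α → α} {mulR : β → β → β} {jL : γ → α} {jR : γ → β}
    (TL : InverseTransversalOn mulL Set.univ (Set.range jL))
    (TR : InverseTransversalOn mulR Set.univ (Set.range jR))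
    (st : β → α → γ) : α × β → α × β → α × β :=
  fun p q => (mulL (mulL p.1 (TL.o p.1)) (jL (st p.2 q.1)),
              mulR (jR (st p.2 q.1)) (mulR (TR.o q.2) q.2))

/-- The multiplication `(e,x)(g,w) = (e(aa⁻¹), a)`, `a = x((x⁻¹x)g)w`, on `I × S⁰`
(Chen-style construction from a left normal band `I` with semilattice transversal
`E⁰ = E(S⁰)`; `σ` embeds idempotents of the inverse semigroup `γ` into the band
`β`, and `π : β → γ` is the semilattice-transversal map `e ↦ e⁰`). -/
def bandMul (mulB : β → β → β) (mulG : γ → γ → γ) (σ : γ → β) (π : β → γ)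
    (inv : γ → γ) (p q : β × γ) : β × γ :=
  let a := mulG (mulG p.2 (π (mulB (σ (mulG (inv p.2) p.2)) q.1))) q.2
  (mulB p.1 (σ (mulG a (inv a))), a)

/-- `T = {(e,x) : e⁰ = xx⁻¹}`. -/
def bandTset (mulG : γ → γ → γ) (π : β → γ) (inv : γ → γ) : Set (β × γ) :=
  {p | π p.1 = mulG p.2 (inv p.2)}

/-- `T⁰ = {(aa⁻¹, a) : a ∈ S⁰}` (with `aa⁻¹` viewed in the band via `σ`). -/
def bandT0 (mulG : γ → γ → γ) (σ : γ → β) (inv : γ → γ) : Set (β × γ) :=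
  {p | ∃ s : γ, p = (σ (mulG s (inv s)), s)}

end Paper

namespace Paper

/-! ### Relative semigroups -/

section Relative

variable {α : Type*} {mul : α → α → α} {U : Set α}

theorem GreenLOn.symm {a b : α} (h : GreenLOn mul U a b) : GreenLOn mul U b a := ⟨h.2, h.1⟩

theorem GreenROn.symm {a b : α} (h : GreenROn mul U a b) : GreenROn mul U b a := ⟨h.2, h.1⟩

theorem GreenLOn.mul_eq_left (hU : SemigroupOn mul U) {a b : α} (hb : b ∈ U)
    (hbb : Idem mul b) (h : GreenLOn mul U a b) : mul a b = a := by
  rcases h.1 with rfl | ⟨u, hu, rfl⟩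
  · exact hbb
  · rw [hU.2 u hu b hb b hb, hbb]

theorem GreenROn.mul_eq_right (hU : SemigroupOn mul U) {a b : α} (hb : b ∈ U)
    (hbb : Idem mul b) (h : GreenROn mul U a b) : mul b a = a := by
  rcases h.1 with rfl | ⟨u, hu, rfl⟩
  · exact hbb
  · rw [← hU.2 b hb b hb u hu, hbb]

end Relative

theorem semigroupOn_univ (S : Type*) [Semigroup S] :
    SemigroupOn (mulOf S) (Set.univ : Set S) :=
  ⟨fun _ _ _ _ => trivial, fun a _ b _ c _ => mul_assoc a b c⟩

/-! ### Adequate transversals of a semigroup -/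

namespace AdequateTransversalOn

variable {S : Type*} [Semigroup S] {S0 : Set S}
  (T : AdequateTransversalOn (mulOf S) Set.univ S0)

theorem plus_mul_plus {s : S} (hs : s ∈ S0) : T.plus s * T.plus s = T.plus s :=
  T.plus_idem s hs

theorem star_mul_star {s : S} (hs : s ∈ S0) : T.star s * T.star s = T.star s :=
  T.star_idem s hs

theorem plus_mul {s : S} (hs : s ∈ S0) : T.plus s * s = s :=
  ((T.plus_rstar s hs).2 (T.plus s) trivial).2 (T.plus_idem s hs)

theorem mul_star {s : S} (hs : s ∈ S0) : s * T.star s = s :=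
  ((T.star_lstar s hs).2 (T.star s) trivial).2 (T.star_idem s hs)

theorem mul_plus_of_mul {s x : S} (hs : s ∈ S0) (h : x * s = s) :
    x * T.plus s = T.plus s :=
  ((T.plus_rstar s hs).2 x trivial).1 h

theorem star_mul_of_mul {s x : S} (hs : s ∈ S0) (h : s * x = s) :
    T.star s * x = T.star s :=
  ((T.star_lstar s hs).2 x trivial).1 h

theorem mul_eq_mul_iff_plus {s : S} (hs : s ∈ S0) (x y : S) :
    x * s = y * s ↔ x * T.plus s = y * T.plus s :=
  (T.plus_rstar s hs).1 x trivial y trivial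

theorem mul_eq_mul_iff_star {s : S} (hs : s ∈ S0) (x y : S) :
    s * x = s * y ↔ T.star s * x = T.star s * y :=
  (T.star_lstar s hs).1 x trivial y trivial

theorem plus_eq_of_idem {s : S} (hs : s ∈ S0) (h : s * s = s) : T.plus s = s := by
  have h1 := T.mul_plus_of_mul hs h
  have h2 : s * T.plus s = T.plus s * s :=
    T.idem_comm s hs _ (T.plus_mem s hs) h (T.plus_idem s hs)
  rw [← h1, h2, T.plus_mul hs]

theorem star_eq_of_idem {s : S} (hs : s ∈ S0) (h : s * s = s) : T.star s = s := by
  have h1 := T.star_mul_of_mul hs h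
  have h2 : s * T.star s = T.star s * s :=
    T.idem_comm s hs _ (T.star_mem s hs) h (T.star_idem s hs)
  rw [← h1, ← h2, T.mul_star hs]

theorem e_mul_plus (x : S) : T.e x * T.plus (T.bar x) = T.e x :=
  (T.e_greenL x trivial).mul_eq_left (semigroupOn_univ S) trivial
    (T.plus_idem _ (T.bar_mem x trivial))

theorem plus_mul_e (x : S) : T.plus (T.bar x) * T.e x = T.plus (T.bar x) :=
  (T.e_greenL x trivial).symm.mul_eq_left (semigroupOn_univ S) trivial (T.e_idem x trivial)

theorem star_mul_f (x : S) : T.star (T.bar x) * T.f x = T.f x :=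
  (T.f_greenR x trivial).mul_eq_right (semigroupOn_univ S) trivial
    (T.star_idem _ (T.bar_mem x trivial))

theorem f_mul_star (x : S) : T.f x * T.star (T.bar x) = T.star (T.bar x) :=
  (T.f_greenR x trivial).symm.mul_eq_right (semigroupOn_univ S) trivial (T.f_idem x trivial)

theorem e_mul_bar_mul_f (x : S) : T.e x * T.bar x * T.f x = x := (T.decomp x trivial).symm

theorem factors_eq {s e f : S} (hs : s ∈ S0) (he : e * T.plus s = e)
    (he' : T.plus s * e = T.plus s) (hf : T.star s * f = f) (hf' : f * T.star s = T.star s) :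
    T.bar (e * s * f) = s ∧ T.e (e * s * f) = e ∧ T.f (e * s * f) = f := by
  have hee : e * e = e := by
    calc e * e = e * T.plus s * e := by rw [he]
      _ = e := by rw [mul_assoc, he', he]
  have hff : f * f = f := by
    calc f * f = f * (T.star s * f) := by rw [hf]
      _ = f := by rw [← mul_assoc, hf', hf]
  obtain ⟨h1, h2, h3⟩ := T.unique (e * s * f) trivial s hs e trivial f trivial hee hff rfl
    ⟨.inr ⟨e, trivial, he⟩, .inr ⟨T.plus s, trivial, he'⟩⟩
    ⟨.inr ⟨f, trivial, hf⟩, .inr ⟨T.star s, trivial, hf'⟩⟩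
  exact ⟨h1.symm, h2.symm, h3.symm⟩

/-- Restricting an idempotent `e ℒ p` to the smaller idempotent `q⁺ ≤ p`. -/
theorem restrict_e {e p q : S} (hp : p ∈ S0) (hq : q ∈ S0) (hep : e * p = e)
    (hpe : p * e = p) (hpq : p * q = q) :
    e * T.plus q * T.plus q = e * T.plus q ∧ T.plus q * (e * T.plus q) = T.plus q ∧
      e * T.plus q * q = e * q := by
  have hpp : p * p = p := by
    calc p * p = p * (e * p) := by rw [← mul_assoc, hpe]
      _ = p := by rw [hep, hpe]
  have h : T.plus q * p = T.plus q := by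
    have : p * T.plus q = T.plus q * p :=
      T.idem_comm p hp _ (T.plus_mem q hq) hpp (T.plus_idem q hq)
    rw [← this, T.mul_plus_of_mul hq hpq]
  have h' : T.plus q * e = T.plus q := by
    calc T.plus q * e = T.plus q * p * e := by rw [h]
      _ = T.plus q := by rw [mul_assoc, hpe, h]
  refine ⟨by rw [mul_assoc, T.plus_mul_plus hq], ?_, by rw [mul_assoc, T.plus_mul hq]⟩
  rw [← mul_assoc, h', T.plus_mul_plus hq]

/-- Restricting an idempotent `f ℛ r` to the smaller idempotent `q⋆ ≤ r`. -/
theorem restrict_f {f r q : S} (hr : r ∈ S0) (hq : q ∈ S0) (hrf : r * f = f)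
    (hfr : f * r = r) (hqr : q * r = q) :
    T.star q * (T.star q * f) = T.star q * f ∧ T.star q * f * T.star q = T.star q ∧
      q * (T.star q * f) = q * f := by
  have hrr : r * r = r := by
    calc r * r = r * f * r := by rw [mul_assoc, hfr]
      _ = r := by rw [hrf, hfr]
  have h : r * T.star q = T.star q := by
    have : r * T.star q = T.star q * r :=
      T.idem_comm r hr _ (T.star_mem q hq) hrr (T.star_idem q hq)
    rw [this, T.star_mul_of_mul hq hqr]
  have h' : f * T.star q = T.star q := by
    calc f * T.star q = f * (r * T.star q) := by rw [h]
      _ = T.star q := by rw [← mul_assoc, hfr, h]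
  refine ⟨by rw [← mul_assoc, T.star_mul_star hq], ?_, by rw [← mul_assoc, T.mul_star hq]⟩
  rw [mul_assoc, h', T.star_mul_star hq]

theorem factors_eq_of_le {e p q r f : S} (hp : p ∈ S0) (hq : q ∈ S0) (hr : r ∈ S0)
    (hep : e * p = e) (hpe : p * e = p) (hpq : p * q = q)
    (hrf : r * f = f) (hfr : f * r = r) (hqr : q * r = q) :
    T.bar (e * q * f) = q ∧ T.e (e * q * f) = e * T.plus q ∧
      T.f (e * q * f) = T.star q * f := by
  obtain ⟨a1, a2, a3⟩ := T.restrict_e hp hq hep hpe hpq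
  obtain ⟨b1, b2, b3⟩ := T.restrict_f hr hq hrf hfr hqr
  have := T.factors_eq hq a1 a2 b1 b2
  rwa [a3, mul_assoc, b3, ← mul_assoc] at this

theorem factors_mul_left {e p q : S} (hp : p ∈ S0) (hq : q ∈ S0)
    (hep : e * p = e) (hpe : p * e = p) (hpq : p * q = q) :
    T.bar (e * q) = q ∧ T.e (e * q) = e * T.plus q ∧ T.f (e * q) = T.star q := by
  have h := T.star_mul_star hq
  have := T.factors_eq_of_le hp hq (T.star_mem q hq) hep hpe hpq h h (T.mul_star hq)
  rwa [mul_assoc, T.mul_star hq, h] at this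

theorem factors_mul_right {q r f : S} (hq : q ∈ S0) (hr : r ∈ S0)
    (hrf : r * f = f) (hfr : f * r = r) (hqr : q * r = q) :
    T.bar (q * f) = q ∧ T.e (q * f) = T.plus q ∧ T.f (q * f) = T.star q * f := by
  have h := T.plus_mul_plus hq
  have := T.factors_eq_of_le (T.plus_mem q hq) hq hr h h (T.plus_mul hq) hrf hfr hqr
  rwa [T.plus_mul hq, h] at this

theorem factors_of_mem {s : S} (hs : s ∈ S0) :
    T.bar s = s ∧ T.e s = T.plus s ∧ T.f s = T.star s := by
  have := T.factors_mul_left (T.plus_mem s hs) hs (T.plus_mul_plus hs) (T.plus_mul_plus hs)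
    (T.plus_mul hs)
  rwa [T.plus_mul hs, T.plus_mul_plus hs] at this

theorem f_eq_star_of_leftAdequate (hS : LeftAdequateOn (mulOf S) Set.univ) (x : S) :
    T.f x = T.star (T.bar x) := by
  have h1 := T.star_mul_f x
  have h2 := T.f_mul_star x
  refine hS.2 _ trivial _ trivial (T.f_idem x trivial) (T.star_idem _ (T.bar_mem x trivial))
    ⟨fun y _ z _ => ?_, fun y _ => ?_⟩ <;> simp only [mulOf]
  · constructor <;> intro h
    · rw [← h2, ← mul_assoc, h, mul_assoc]
    · rw [← h1, ← mul_assoc, h, mul_assoc]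
  · constructor <;> intro h
    · rw [← h2, ← mul_assoc, h]
    · rw [← h1, ← mul_assoc, h]

theorem e_eq_plus_of_rightAdequate (hS : RightAdequateOn (mulOf S) Set.univ) (x : S) :
    T.e x = T.plus (T.bar x) := by
  have h1 := T.plus_mul_e x
  have h2 := T.e_mul_plus x
  refine hS.2 _ trivial _ trivial (T.e_idem x trivial) (T.plus_idem _ (T.bar_mem x trivial))
    ⟨fun y _ z _ => ?_, fun y _ => ?_⟩ <;> simp only [mulOf]
  · constructor <;> intro h
    · rw [← h1, mul_assoc, h, mul_assoc]
    · rw [← h2, mul_assoc, h, mul_assoc]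
  · constructor <;> intro h
    · rw [← h1, mul_assoc, h]
    · rw [← h2, mul_assoc, h]

/-- If `h w h = h` where `w = h⋆ w h⁺` is an idempotent of the transversal, then `h` is
idempotent. -/
theorem idem_of_mul_idem_mul {h w : S} (hh : h ∈ S0) (hw : w ∈ S0) (hww : w * w = w)
    (hsw : T.star h * w = w) (hwp : w * T.plus h = w) (hwh : h * w * h = h) : h * h = h := by
  have h1 : h * w = T.plus h := by
    have := T.mul_plus_of_mul hh hwh
    rwa [mul_assoc, hwp] at this
  have h2 : w * h = T.star h := by
    have := T.star_mul_of_mul hh (x := w * h) (by rw [← mul_assoc, hwh])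
    rwa [← mul_assoc, hsw] at this
  have h3 : w * T.star h = T.star h * w :=
    T.idem_comm w hw _ (T.star_mem h hh) hww (T.star_idem h hh)
  have h4 : T.star h = w := by
    rw [← hsw, ← h3, ← h2, ← mul_assoc, hww]
  have h5 : h = T.plus h := by rw [← h1, ← h4, T.mul_star hh]
  calc h * h = T.plus h * h := by rw [← h5]
    _ = h := T.plus_mul hh

theorem eq_e_mul_bar {x : S} (hx : x ∈ T.Lset) : T.e x * T.bar x = x := by
  have hb := T.bar_mem x trivial
  have := T.e_mul_bar_mul_f x
  rwa [hx.2, (T.factors_of_mem hb).2.2, mul_assoc, T.mul_star hb] at this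

theorem eq_bar_mul_f {x : S} (hx : x ∈ T.Rset) : T.bar x * T.f x = x := by
  have hb := T.bar_mem x trivial
  have := T.e_mul_bar_mul_f x
  rwa [hx.2, (T.factors_of_mem hb).2.1, T.plus_mul hb] at this

theorem factors_e_mul_bar (x : S) : T.bar (T.e x * T.bar x) = T.bar x ∧
    T.e (T.e x * T.bar x) = T.e x ∧ T.f (T.e x * T.bar x) = T.star (T.bar x) := by
  have hb := T.bar_mem x trivial
  have := T.factors_mul_left (T.plus_mem _ hb) hb (T.e_mul_plus x) (T.plus_mul_e x)
    (T.plus_mul hb)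
  rwa [T.e_mul_plus] at this

theorem factors_bar_mul_f (x : S) : T.bar (T.bar x * T.f x) = T.bar x ∧
    T.e (T.bar x * T.f x) = T.plus (T.bar x) ∧ T.f (T.bar x * T.f x) = T.f x := by
  have hb := T.bar_mem x trivial
  have := T.factors_mul_right hb (T.star_mem _ hb) (T.star_mul_f x) (T.f_mul_star x)
    (T.mul_star hb)
  rwa [T.star_mul_f] at this

theorem phiMap_bijOn : Set.BijOn (phiMap T) Set.univ (spSet T) := by
  refine ⟨fun x _ => ?_, fun x _ y _ h => ?_, fun p hp => ?_⟩
  · have hb := T.factors_of_mem (T.bar_mem x trivial)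
    obtain ⟨l1, -, l3⟩ := T.factors_e_mul_bar x
    obtain ⟨r1, r2, -⟩ := T.factors_bar_mul_f x
    refine ⟨⟨trivial, ?_⟩, ⟨trivial, ?_⟩, ?_⟩ <;> simp only [phiMap, mulOf]
    · rw [l3, l1, hb.2.2]
    · rw [r2, r1, hb.2.1]
    · rw [l1, r1]
  · obtain ⟨hl, hr⟩ := Prod.ext_iff.1 h
    simp only [phiMap, mulOf] at hl hr
    obtain ⟨x1, x2, -⟩ := T.factors_e_mul_bar x
    obtain ⟨y1, y2, -⟩ := T.factors_e_mul_bar y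
    obtain ⟨-, -, x3⟩ := T.factors_bar_mul_f x
    obtain ⟨-, -, y3⟩ := T.factors_bar_mul_f y
    rw [hl] at x1 x2
    rw [hr] at x3
    rw [← T.e_mul_bar_mul_f x, ← T.e_mul_bar_mul_f y, ← x1, ← x2, ← x3, y1, y2, y3]
  · obtain ⟨y, b⟩ := p
    obtain ⟨hy, hb, hyb : T.bar y = T.bar b⟩ := hp
    obtain ⟨h1, h2, h3⟩ := T.factors_eq (f := T.f b) (T.bar_mem y trivial) (T.e_mul_plus y)
      (T.plus_mul_e y) (by rw [hyb, T.star_mul_f]) (by rw [hyb, T.f_mul_star])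
    refine ⟨T.e y * T.bar y * T.f b, trivial, ?_⟩
    simp only [phiMap, mulOf, h1, h2, h3]
    rw [T.eq_e_mul_bar hy, hyb, T.eq_bar_mul_f hb]

namespace IsMultiplicative

variable {T}

theorem f_mul_e_mem (hT : T.IsMultiplicative) (x y : S) : T.f x * T.e y ∈ S0 :=
  (hT _ ⟨x, trivial, rfl⟩ _ ⟨y, trivial, rfl⟩).1

theorem f_mul_e_idem (hT : T.IsMultiplicative) (x y : S) :
    T.f x * T.e y * (T.f x * T.e y) = T.f x * T.e y :=
  (hT _ ⟨x, trivial, rfl⟩ _ ⟨y, trivial, rfl⟩).2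

theorem bar_mul_f_mul_e_mul_bar_mem (hT : T.IsMultiplicative) (x y : S) :
    T.bar x * T.f x * (T.e y * T.bar y) ∈ S0 := by
  have h := T.mul_mem _ (T.mul_mem _ (T.bar_mem x trivial) _ (hT.f_mul_e_mem x y)) _
    (T.bar_mem y trivial)
  simpa only [mulOf, mul_assoc] using h

theorem bar_idem (hT : T.IsMultiplicative) {x : S} (hx : x * x = x) :
    T.bar x * T.bar x = T.bar x := by
  have hb := T.bar_mem x trivial
  refine T.idem_of_mul_idem_mul hb (hT.f_mul_e_mem x x) (hT.f_mul_e_idem x x)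
    (by rw [← mul_assoc, T.star_mul_f]) (by rw [mul_assoc, T.e_mul_plus]) ?_
  have hbar : T.plus (T.bar x) * x * T.star (T.bar x) = T.bar x := by
    have : T.plus (T.bar x) * (T.e x * T.bar x * T.f x) * T.star (T.bar x) = T.bar x := by
      rw [mul_assoc (T.e x), ← mul_assoc, T.plus_mul_e, mul_assoc, mul_assoc, T.f_mul_star,
        T.mul_star hb, T.plus_mul hb]
    rwa [T.e_mul_bar_mul_f] at this
  calc T.bar x * (T.f x * T.e x) * T.bar x
      = T.plus (T.bar x) * T.e x * T.bar x * (T.f x * T.e x) * T.bar x *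
          (T.f x * T.star (T.bar x)) := by
        rw [T.plus_mul_e, T.f_mul_star, T.plus_mul hb]
        simp only [mul_assoc, T.mul_star hb]
    _ = T.plus (T.bar x) * ((T.e x * T.bar x * T.f x) * (T.e x * T.bar x * T.f x)) *
          T.star (T.bar x) := by simp only [mul_assoc]
    _ = T.bar x := by rw [T.e_mul_bar_mul_f, hx, hbar]

theorem eq_f_of_idem (hT : T.IsMultiplicative) {x : S} (hx : x ∈ T.Rset) (h : x * x = x) :
    T.f x = x := by
  have hs := T.star_eq_of_idem (T.bar_mem x trivial) (hT.bar_idem h)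
  have hf := T.star_mul_f x
  rwa [hs, T.eq_bar_mul_f hx, eq_comm] at hf

theorem eq_e_of_idem (hT : T.IsMultiplicative) {x : S} (hx : x ∈ T.Lset) (h : x * x = x) :
    T.e x = x := by
  have hs := T.plus_eq_of_idem (T.bar_mem x trivial) (hT.bar_idem h)
  have he := T.e_mul_plus x
  rwa [hs, T.eq_e_mul_bar hx, eq_comm] at he

theorem phiMap_mul (hT : T.IsMultiplicative) (x y : S) :
    phiMap T (x * y) = spMul T (phiMap T x) (phiMap T y) := by
  have hx := T.bar_mem x trivial
  have hy := T.bar_mem y trivial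
  have hq := hT.bar_mul_f_mul_e_mul_bar_mem x y
  set q := T.bar x * T.f x * (T.e y * T.bar y) with q_def
  have hpq : T.plus (T.bar x) * q = q := by
    rw [q_def, ← mul_assoc, ← mul_assoc (T.plus _), T.plus_mul hx]
  have hqr : q * T.star (T.bar y) = q := by
    rw [q_def, mul_assoc, mul_assoc (T.e y), T.mul_star hy]
  have hxy : x * y = T.e x * q * T.f y := by
    conv_lhs => rw [← T.e_mul_bar_mul_f x, ← T.e_mul_bar_mul_f y]
    simp only [q_def, mul_assoc]
  obtain ⟨h1, h2, h3⟩ := T.factors_eq_of_le (T.plus_mem _ hx) hq (T.star_mem _ hy)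
    (T.e_mul_plus x) (T.plus_mul_e x) hpq (T.star_mul_f y) (T.f_mul_star y) hqr
  rw [← hxy] at h1 h2 h3
  simp only [phiMap, spMul, mulOf, h1, h2, h3, (T.factors_e_mul_bar x).2.1,
    (T.factors_bar_mul_f y).2.2, ← q_def]
  rw [mul_assoc (T.e x), T.plus_mul hq, ← mul_assoc q, T.mul_star hq]

end IsMultiplicative

end AdequateTransversalOn

/-! ### The abstract spined product -/

section SpinedProduct

variable {L R G : Type*} [Semigroup L] [Semigroup R] [Semigroup G]

/-- The hypotheses on `∗ : R × L → S⁰` in bilinear form, together with the operations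
`P s = s⁺` and `Q s = s⋆` of `S⁰`. -/
structure SpinedData (jL : G → L) (jR : G → R)
    (TL : AdequateTransversalOn (mulOf L) Set.univ (Set.range jL))
    (TR : AdequateTransversalOn (mulOf R) Set.univ (Set.range jR))
    (st : R → L → G) (P Q : G → G) : Prop where
  injL : Function.Injective jL
  injR : Function.Injective jR
  mapL : ∀ s t : G, jL (s * t) = jL s * jL t
  mapR : ∀ s t : G, jR (s * t) = jR s * jR t
  plusL : ∀ s, TL.plus (jL s) = jL (P s)
  plusR : ∀ s, TR.plus (jR s) = jR (P s)
  starL : ∀ s, TL.star (jL s) = jL (Q s)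
  starR : ∀ s, TR.star (jR s) = jR (Q s)
  f_left : ∀ x, TL.f x = TL.star (TL.bar x)
  e_right : ∀ a, TR.e a = TR.plus (TR.bar a)
  smul_st : ∀ g b z, st (jR g * b) z = g * st b z
  st_smul : ∀ b z g, st b (z * jL g) = st b z * g
  st_left : ∀ s x, jL (st (jR s) x) = jL s * x
  st_right : ∀ a s, jR (st a (jL s)) = a * jR s
  st_idem : ∀ e f, e * e = e → f * f = f → st e f * st e f = st e f

/-- `e ℒ p`, `p q = q = q r` and `r ℛ f`: the conditions under which `(e, q, f)` represents
the element `(e q, q f)` of the spined product. -/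
structure Factorization (jL : G → L) (jR : G → R) (e : L) (p q r : G) (f : R) : Prop where
  e_mul : e * jL p = e
  mul_e : jL p * e = jL p
  p_mul : p * q = q
  mul_r : q * r = q
  mul_f : jR r * f = f
  f_mul : f * jR r = jR r

/-- The element `(e q, q f)` of the spined product. -/
def spinedElt (jL : G → L) (jR : G → R) (e : L) (q : G) (f : R) : L × R :=
  (e * jL q, jR q * f)

namespace SpinedData

variable {jL : G → L} {jR : G → R}
  {TL : AdequateTransversalOn (mulOf L) Set.univ (Set.range jL)}
  {TR : AdequateTransversalOn (mulOf R) Set.univ (Set.range jR)}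
  {st : R → L → G} {P Q : G → G}

theorem comm (D : SpinedData jL jR TL TR st P Q) {u v : G} (hu : u * u = u)
    (hv : v * v = v) : u * v = v * u := by
  apply D.injL
  rw [D.mapL, D.mapL]
  exact TL.idem_comm _ ⟨u, rfl⟩ _ ⟨v, rfl⟩ (by rw [Idem, mulOf, ← D.mapL, hu])
    (by rw [Idem, mulOf, ← D.mapL, hv])

theorem P_mul_P (D : SpinedData jL jR TL TR st P Q) (s : G) : P s * P s = P s := by
  apply D.injL
  rw [D.mapL, ← D.plusL, TL.plus_mul_plus ⟨s, rfl⟩]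

theorem Q_mul_Q (D : SpinedData jL jR TL TR st P Q) (s : G) : Q s * Q s = Q s := by
  apply D.injL
  rw [D.mapL, ← D.starL, TL.star_mul_star ⟨s, rfl⟩]

theorem P_mul (D : SpinedData jL jR TL TR st P Q) (s : G) : P s * s = s := by
  apply D.injL
  rw [D.mapL, ← D.plusL, TL.plus_mul ⟨s, rfl⟩]

theorem mul_Q (D : SpinedData jL jR TL TR st P Q) (s : G) : s * Q s = s := by
  apply D.injL
  rw [D.mapL, ← D.starL, TL.mul_star ⟨s, rfl⟩]

theorem P_of_idem (D : SpinedData jL jR TL TR st P Q) {s : G} (h : s * s = s) : P s = s := by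
  apply D.injL
  rw [← D.plusL, TL.plus_eq_of_idem ⟨s, rfl⟩ (by rw [← D.mapL, h])]

theorem Q_of_idem (D : SpinedData jL jR TL TR st P Q) {s : G} (h : s * s = s) : Q s = s := by
  apply D.injL
  rw [← D.starL, TL.star_eq_of_idem ⟨s, rfl⟩ (by rw [← D.mapL, h])]

theorem st_mul (D : SpinedData jL jR TL TR st P Q) (g h : G) :
    st (jR g) (jL h) = g * h := by
  apply D.injL
  rw [D.st_left, D.mapL]

section Factorization

variable {e : L} {p q r : G} {f : R}

theorem factors_left (D : SpinedData jL jR TL TR st P Q)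
    (h : Factorization jL jR e p q r f) :
    TL.bar (e * jL q) = jL q ∧ TL.e (e * jL q) = e * jL (P q) := by
  obtain ⟨h1, h2, -⟩ := TL.factors_mul_left ⟨p, rfl⟩ ⟨q, rfl⟩ h.e_mul h.mul_e
    (by rw [← D.mapL, h.p_mul])
  exact ⟨h1, by rw [h2, D.plusL]⟩

theorem factors_right (D : SpinedData jL jR TL TR st P Q)
    (h : Factorization jL jR e p q r f) :
    TR.bar (jR q * f) = jR q ∧ TR.f (jR q * f) = jR (Q q) * f := by
  obtain ⟨h1, -, h2⟩ := TR.factors_mul_right ⟨q, rfl⟩ ⟨r, rfl⟩ h.mul_f h.f_mul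
    (by rw [← D.mapR, h.mul_r])
  exact ⟨h1, by rw [h2, D.starR]⟩

theorem mem_absTset (D : SpinedData jL jR TL TR st P Q)
    (h : Factorization jL jR e p q r f) : spinedElt jL jR e q f ∈ absTset TL TR :=
  ⟨q, (D.factors_left h).1.symm, (D.factors_right h).1.symm⟩

theorem exists_factorization (D : SpinedData jL jR TL TR st P Q) {x : L × R}
    (hx : x ∈ absTset TL TR) :
    ∃ e q f, Factorization jL jR e (P q) q (Q q) f ∧ x = spinedElt jL jR e q f := by
  obtain ⟨x, a⟩ := x
  obtain ⟨q, hL : jL q = TL.bar x, hR : jR q = TR.bar a⟩ := hx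
  refine ⟨TL.e x, q, TR.f a, ⟨?_, ?_, D.P_mul q, D.mul_Q q, ?_, ?_⟩, ?_⟩
  · rw [← D.plusL, hL, TL.e_mul_plus]
  · rw [← D.plusL, hL, TL.plus_mul_e]
  · rw [← D.starR, hR, TR.star_mul_f]
  · rw [← D.starR, hR, TR.f_mul_star]
  · have h1 := TL.e_mul_bar_mul_f x
    have h2 := TR.e_mul_bar_mul_f a
    rw [D.f_left, mul_assoc, TL.mul_star (TL.bar_mem x trivial)] at h1
    rw [D.e_right, TR.plus_mul (TR.bar_mem a trivial)] at h2
    rw [spinedElt, hL, hR, h1, h2]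

theorem _root_.Paper.Factorization.mul {e' : L} {p' q' r' : G}
    {f' : R} (h : Factorization jL jR e p q r f) (h' : Factorization jL jR e' p' q' r' f') :
    Factorization jL jR e p (q * st f e' * q') r' f' where
  e_mul := h.e_mul
  mul_e := h.mul_e
  p_mul := by rw [← mul_assoc, ← mul_assoc, h.p_mul]
  mul_r := by rw [mul_assoc, h'.mul_r]
  mul_f := h'.mul_f
  f_mul := h'.f_mul

theorem absMul_spinedElt (D : SpinedData jL jR TL TR st P Q) {e' : L} {p' q' r' : G}
    {f' : R} (h : Factorization jL jR e p q r f) (h' : Factorization jL jR e' p' q' r' f') :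
    absMul TL TR st (spinedElt jL jR e q f) (spinedElt jL jR e' q' f') =
      spinedElt jL jR e (q * st f e' * q') f' := by
  have hst : st (jR q * f) (e' * jL q') = q * st f e' * q' := by
    rw [D.smul_st, D.st_smul, mul_assoc]
  simp only [absMul, spinedElt, mulOf, hst, (D.factors_left h).2, (D.factors_right h').2]
  rw [mul_assoc, ← D.mapL, ← mul_assoc, ← mul_assoc, D.P_mul, ← mul_assoc, ← D.mapR,
    mul_assoc _ q', D.mul_Q]

theorem spinedElt_inj (D : SpinedData jL jR TL TR st P Q) {e' : L} {p' q' r' : G}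
    {f' : R} (h : Factorization jL jR e p q r f) (h' : Factorization jL jR e' p' q' r' f')
    (H : spinedElt jL jR e q f = spinedElt jL jR e' q' f') :
    q = q' ∧ e * jL (P q) = e' * jL (P q') ∧ jR (Q q) * f = jR (Q q') * f' := by
  obtain ⟨hl, hr⟩ := Prod.ext_iff.1 H
  simp only [spinedElt] at hl hr
  have h1 := D.factors_left h
  have h2 := D.factors_right h
  rw [hl] at h1
  rw [hr] at h2
  refine ⟨D.injL ?_, ?_, ?_⟩
  · rw [← h1.1, (D.factors_left h').1]
  · rw [← h1.2, (D.factors_left h').2]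
  · rw [← h2.2, (D.factors_right h').2]

theorem spinedElt_eq_iff_left (D : SpinedData jL jR TL TR st P Q) {e' : L} {p' q' r' : G}
    (h : Factorization jL jR e p q r f) (h' : Factorization jL jR e' p' q' r' f) :
    spinedElt jL jR e q f = spinedElt jL jR e' q' f ↔ e * jL q = e' * jL q' := by
  refine ⟨fun H => (Prod.ext_iff.1 H).1, fun H => ?_⟩
  have hq : q = q' := by
    apply D.injL
    rw [← (D.factors_left h).1, H, (D.factors_left h').1]
  rw [spinedElt, spinedElt, H, hq]

theorem spinedElt_eq_iff_right (D : SpinedData jL jR TL TR st P Q) {p' q' r' : G} {f' : R}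
    (h : Factorization jL jR e p q r f) (h' : Factorization jL jR e p' q' r' f') :
    spinedElt jL jR e q f = spinedElt jL jR e q' f' ↔ jR q * f = jR q' * f' := by
  refine ⟨fun H => (Prod.ext_iff.1 H).2, fun H => ?_⟩
  have hq : q = q' := by
    apply D.injR
    rw [← (D.factors_right h).1, H, (D.factors_right h').1]
  rw [spinedElt, spinedElt, H, hq]

theorem factorization_plus (D : SpinedData jL jR TL TR st P Q)
    (h : Factorization jL jR e (P q) q r f) :
    Factorization jL jR e (P q) (P q) (P q) (jR (P q)) where
  e_mul := h.e_mul
  mul_e := h.mul_e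
  p_mul := D.P_mul_P q
  mul_r := D.P_mul_P q
  mul_f := by rw [← D.mapR, D.P_mul_P]
  f_mul := by rw [← D.mapR, D.P_mul_P]

theorem factorization_star (D : SpinedData jL jR TL TR st P Q)
    (h : Factorization jL jR e p q (Q q) f) :
    Factorization jL jR (jL (Q q)) (Q q) (Q q) (Q q) f where
  e_mul := by rw [← D.mapL, D.Q_mul_Q]
  mul_e := by rw [← D.mapL, D.Q_mul_Q]
  p_mul := D.Q_mul_Q q
  mul_r := D.Q_mul_Q q
  mul_f := h.mul_f
  f_mul := h.f_mul

theorem factorization_diag (D : SpinedData jL jR TL TR st P Q) (s : G) :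
    Factorization jL jR (jL (P s)) (P s) s (Q s) (jR (Q s)) where
  e_mul := by rw [← D.mapL, D.P_mul_P]
  mul_e := by rw [← D.mapL, D.P_mul_P]
  p_mul := D.P_mul s
  mul_r := D.mul_Q s
  mul_f := by rw [← D.mapR, D.Q_mul_Q]
  f_mul := by rw [← D.mapR, D.Q_mul_Q]

theorem spinedElt_diag (D : SpinedData jL jR TL TR st P Q) (s : G) :
    spinedElt jL jR (jL (P s)) s (jR (Q s)) = (jL s, jR s) := by
  rw [spinedElt, ← D.mapL, ← D.mapR, D.P_mul, D.mul_Q]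

theorem spinedElt_plus_diag (D : SpinedData jL jR TL TR st P Q)
    (h : Factorization jL jR e (P q) q r f) :
    spinedElt jL jR e (P q) (jR (P q)) = (e, jR (P q)) := by
  rw [spinedElt, h.e_mul, ← D.mapR, D.P_mul_P]

theorem spinedElt_star_diag (D : SpinedData jL jR TL TR st P Q)
    (h : Factorization jL jR e p q (Q q) f) :
    spinedElt jL jR (jL (Q q)) (Q q) f = (jL (Q q), f) := by
  rw [spinedElt, h.mul_f, ← D.mapL, D.Q_mul_Q]

theorem st_P_e (D : SpinedData jL jR TL TR st P Q) (h : Factorization jL jR e p q r f) :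
    st (jR p) e = p := by
  apply D.injL
  rw [D.st_left, h.mul_e]

theorem st_f_Q (D : SpinedData jL jR TL TR st P Q) (h : Factorization jL jR e p q r f) :
    st f (jL r) = r := by
  apply D.injR
  rw [D.st_right, h.f_mul]

theorem idem_plus (D : SpinedData jL jR TL TR st P Q)
    (h : Factorization jL jR e (P q) q r f) :
    Idem (absMul TL TR st) (spinedElt jL jR e (P q) (jR (P q))) := by
  have h1 := D.factorization_plus h
  rw [Idem, D.absMul_spinedElt h1 h1, D.st_P_e h, D.P_mul_P, D.P_mul_P]

theorem idem_star (D : SpinedData jL jR TL TR st P Q)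
    (h : Factorization jL jR e p q (Q q) f) :
    Idem (absMul TL TR st) (spinedElt jL jR (jL (Q q)) (Q q) f) := by
  have h1 := D.factorization_star h
  rw [Idem, D.absMul_spinedElt h1 h1, D.st_f_Q h, D.Q_mul_Q, D.Q_mul_Q]

theorem rStarOn_plus (D : SpinedData jL jR TL TR st P Q)
    (h : Factorization jL jR e (P q) q r f) :
    RStarOn (absMul TL TR st) (absTset TL TR) (spinedElt jL jR e q f)
      (spinedElt jL jR e (P q) (jR (P q))) := by
  have hp := D.factorization_plus h
  have key : ∀ x y : L, x * jL q = y * jL q ↔ x * jL (P q) = y * jL (P q) := fun x y => by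
    rw [TL.mul_eq_mul_iff_plus ⟨q, rfl⟩, D.plusL]
  refine ⟨fun x hx y hy => ?_, fun x hx => ?_⟩
  · obtain ⟨e₁, q₁, f₁, h₁, rfl⟩ := D.exists_factorization hx
    obtain ⟨e₂, q₂, f₂, h₂, rfl⟩ := D.exists_factorization hy
    rw [D.absMul_spinedElt h₁ h, D.absMul_spinedElt h₂ h, D.absMul_spinedElt h₁ hp,
      D.absMul_spinedElt h₂ hp,
      D.spinedElt_eq_iff_left (h₁.mul h) (h₂.mul h),
      D.spinedElt_eq_iff_left (h₁.mul hp) (h₂.mul hp),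
      D.mapL _ q, D.mapL _ q, D.mapL _ (P q), D.mapL _ (P q), ← mul_assoc, ← mul_assoc,
      ← mul_assoc, ← mul_assoc, key]
  · obtain ⟨e₁, q₁, f₁, h₁, rfl⟩ := D.exists_factorization hx
    rw [D.absMul_spinedElt h₁ h, D.absMul_spinedElt h₁ hp,
      D.spinedElt_eq_iff_left (h₁.mul h) h,
      D.spinedElt_eq_iff_left (h₁.mul hp) hp,
      D.mapL _ q, D.mapL _ (P q), ← mul_assoc, ← mul_assoc, key]

theorem lStarOn_star (D : SpinedData jL jR TL TR st P Q)
    (h : Factorization jL jR e p q (Q q) f) :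
    LStarOn (absMul TL TR st) (absTset TL TR) (spinedElt jL jR e q f)
      (spinedElt jL jR (jL (Q q)) (Q q) f) := by
  have hs := D.factorization_star h
  have key : ∀ x y : R, jR q * x = jR q * y ↔ jR (Q q) * x = jR (Q q) * y := fun x y => by
    rw [TR.mul_eq_mul_iff_star ⟨q, rfl⟩, D.starR]
  refine ⟨fun x hx y hy => ?_, fun x hx => ?_⟩
  · obtain ⟨e₁, q₁, f₁, h₁, rfl⟩ := D.exists_factorization hx
    obtain ⟨e₂, q₂, f₂, h₂, rfl⟩ := D.exists_factorization hy
    rw [D.absMul_spinedElt h h₁, D.absMul_spinedElt h h₂, D.absMul_spinedElt hs h₁,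
      D.absMul_spinedElt hs h₂,
      D.spinedElt_eq_iff_right (h.mul h₁) (h.mul h₂),
      D.spinedElt_eq_iff_right (hs.mul h₁) (hs.mul h₂)]
    simp only [D.mapR, mul_assoc]
    exact key _ _
  · obtain ⟨e₁, q₁, f₁, h₁, rfl⟩ := D.exists_factorization hx
    rw [D.absMul_spinedElt h h₁, D.absMul_spinedElt hs h₁,
      D.spinedElt_eq_iff_right (h.mul h₁) h,
      D.spinedElt_eq_iff_right (hs.mul h₁) hs]
    simp only [D.mapR, mul_assoc]
    exact key _ _

theorem idem_middle (D : SpinedData jL jR TL TR st P Q)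
    (h : Factorization jL jR e (P q) q (Q q) f)
    (hi : Idem (absMul TL TR st) (spinedElt jL jR e q f)) : q * q = q := by
  rw [Idem, D.absMul_spinedElt h h] at hi
  obtain ⟨hq, -, -⟩ := D.spinedElt_inj (h.mul h) h hi
  have hee : e * e = e := by
    calc e * e = e * jL (P q) * e := by rw [h.e_mul]
      _ = e := by rw [mul_assoc, h.mul_e, h.e_mul]
  have hff : f * f = f := by
    calc f * f = f * (jR (Q q) * f) := by rw [h.mul_f]
      _ = f := by rw [← mul_assoc, h.f_mul, h.mul_f]
  apply D.injL
  rw [D.mapL]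
  refine TL.idem_of_mul_idem_mul (w := jL (st f e)) ⟨q, rfl⟩ ⟨_, rfl⟩ ?_ ?_ ?_ ?_
  · rw [← D.mapL, D.st_idem f e hff hee]
  · rw [D.starL, ← D.mapL, ← D.smul_st, h.mul_f]
  · rw [D.plusL, ← D.mapL, ← D.st_smul, h.e_mul]
  · rw [← D.mapL, ← D.mapL, hq]

theorem diag_mem (D : SpinedData jL jR TL TR st P Q) (s : G) :
    (jL s, jR s) ∈ absTset TL TR := by
  rw [← D.spinedElt_diag]
  exact D.mem_absTset (D.factorization_diag s)

theorem absMul_diag (D : SpinedData jL jR TL TR st P Q) (s t : G) :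
    absMul TL TR st (jL s, jR s) (jL t, jR t) = (jL (s * t), jR (s * t)) := by
  rw [← D.spinedElt_diag s, ← D.spinedElt_diag t,
    D.absMul_spinedElt (D.factorization_diag s) (D.factorization_diag t), D.st_mul, spinedElt,
    ← D.mapL, ← D.mapR, ← mul_assoc s, D.mul_Q, mul_assoc s, D.P_mul, mul_assoc, D.mul_Q,
    ← mul_assoc, D.P_mul]

end Factorization

theorem semigroupOn (D : SpinedData jL jR TL TR st P Q) :
    SemigroupOn (absMul TL TR st) (absTset TL TR) := by
  refine ⟨fun a ha b hb => ?_, fun a ha b hb c hc => ?_⟩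
  · obtain ⟨e₁, q₁, f₁, h₁, rfl⟩ := D.exists_factorization ha
    obtain ⟨e₂, q₂, f₂, h₂, rfl⟩ := D.exists_factorization hb
    rw [D.absMul_spinedElt h₁ h₂]
    exact D.mem_absTset (h₁.mul h₂)
  · obtain ⟨e₁, q₁, f₁, h₁, rfl⟩ := D.exists_factorization ha
    obtain ⟨e₂, q₂, f₂, h₂, rfl⟩ := D.exists_factorization hb
    obtain ⟨e₃, q₃, f₃, h₃, rfl⟩ := D.exists_factorization hc
    rw [D.absMul_spinedElt h₁ h₂, D.absMul_spinedElt (h₁.mul h₂) h₃,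
      D.absMul_spinedElt h₂ h₃, D.absMul_spinedElt h₁ (h₂.mul h₃)]
    simp only [mul_assoc]

theorem abundantOn (D : SpinedData jL jR TL TR st P Q) :
    AbundantOn (absMul TL TR st) (absTset TL TR) := by
  intro x hx
  obtain ⟨e, q, f, h, rfl⟩ := D.exists_factorization hx
  exact ⟨⟨_, D.mem_absTset (D.factorization_plus h), D.idem_plus h, D.rStarOn_plus h⟩,
    ⟨_, D.mem_absTset (D.factorization_star h), D.idem_star h, D.lStarOn_star h⟩⟩

theorem isoOn (D : SpinedData jL jR TL TR st P Q) :
    IsoOn (mulOf G) (absMul TL TR st) Set.univ (absT0 jL jR) := by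
  refine ⟨fun s => (jL s, jR s), ⟨fun s _ => ⟨s, rfl⟩, fun s _ t _ h => ?_, ?_⟩,
    fun s _ t _ => (D.absMul_diag s t).symm⟩
  · exact D.injL (Prod.ext_iff.1 h).1
  · rintro _ ⟨s, rfl⟩
    exact ⟨s, trivial, rfl⟩

theorem bar_spinedElt (D : SpinedData jL jR TL TR st P Q) {e : L} {p q r : G} {f : R}
    (h : Factorization jL jR e p q r f) :
    (TL.bar (spinedElt jL jR e q f).1, TR.bar (spinedElt jL jR e q f).2) = (jL q, jR q) :=
  Prod.ext (D.factors_left h).1 (D.factors_right h).1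

theorem e_spinedElt (D : SpinedData jL jR TL TR st P Q) {e : L} {q r : G} {f : R}
    (h : Factorization jL jR e (P q) q r f) :
    (TL.e (spinedElt jL jR e q f).1, TR.plus (TR.bar (spinedElt jL jR e q f).2)) =
      spinedElt jL jR e (P q) (jR (P q)) := by
  rw [D.spinedElt_plus_diag h]
  refine Prod.ext ((D.factors_left h).2.trans h.e_mul) ?_
  simp only [spinedElt, (D.factors_right h).1, D.plusR]

theorem f_spinedElt (D : SpinedData jL jR TL TR st P Q) {e : L} {p q : G} {f : R}
    (h : Factorization jL jR e p q (Q q) f) :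
    (TL.star (TL.bar (spinedElt jL jR e q f).1), TR.f (spinedElt jL jR e q f).2) =
      spinedElt jL jR (jL (Q q)) (Q q) f := by
  rw [D.spinedElt_star_diag h]
  refine Prod.ext ?_ ((D.factors_right h).2.trans h.mul_f)
  simp only [spinedElt, (D.factors_left h).1, D.starL]

theorem diag_P (D : SpinedData jL jR TL TR st P Q) (s : G) :
    spinedElt jL jR (jL (P s)) (P s) (jR (P s)) = (jL (P s), jR (P s)) := by
  rw [spinedElt, ← D.mapL, ← D.mapR, D.P_mul_P]

theorem diag_Q (D : SpinedData jL jR TL TR st P Q) (s : G) :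
    spinedElt jL jR (jL (Q s)) (Q s) (jR (Q s)) = (jL (Q s), jR (Q s)) := by
  rw [spinedElt, ← D.mapL, ← D.mapR, D.Q_mul_Q]

theorem diag_idem_iff (D : SpinedData jL jR TL TR st P Q) (s : G) :
    Idem (absMul TL TR st) (jL s, jR s) ↔ s * s = s := by
  rw [Idem, D.absMul_diag]
  exact ⟨fun h => D.injL (Prod.ext_iff.1 h).1, fun h => by rw [h]⟩

theorem factorization_diag_P (D : SpinedData jL jR TL TR st P Q) (s : G) :
    Factorization jL jR (jL (P s)) (P s) (P s) (P s) (jR (P s)) :=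
  D.factorization_plus (D.factorization_diag s)

theorem factorization_diag_Q (D : SpinedData jL jR TL TR st P Q) (s : G) :
    Factorization jL jR (jL (Q s)) (Q s) (Q s) (Q s) (jR (Q s)) :=
  D.factorization_star (D.factorization_diag s)

theorem decomp_spinedElt (D : SpinedData jL jR TL TR st P Q) {e : L} {q : G} {f : R}
    (h : Factorization jL jR e (P q) q (Q q) f) :
    absMul TL TR st (absMul TL TR st (spinedElt jL jR e (P q) (jR (P q))) (jL q, jR q))
      (spinedElt jL jR (jL (Q q)) (Q q) f) = spinedElt jL jR e q f := by
  have hp := D.factorization_plus h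
  have hd := D.factorization_diag q
  rw [← D.spinedElt_diag q, D.absMul_spinedElt hp hd,
    D.absMul_spinedElt (hp.mul hd) (D.factorization_star h), D.st_mul, D.st_mul]
  simp only [D.P_mul_P, D.P_mul, D.Q_mul_Q, D.mul_Q]

theorem greenL_plus (D : SpinedData jL jR TL TR st P Q) {e : L} {q r : G} {f : R}
    (h : Factorization jL jR e (P q) q r f) :
    GreenLOn (absMul TL TR st) (absTset TL TR) (spinedElt jL jR e (P q) (jR (P q)))
      (jL (P q), jR (P q)) := by
  have hp := D.factorization_plus h
  have hd := D.factorization_diag_P q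
  refine ⟨.inr ⟨_, D.mem_absTset hp, ?_⟩, .inr ⟨_, D.diag_mem (P q), ?_⟩⟩
  · rw [← D.diag_P, D.absMul_spinedElt hp hd, D.st_mul]
    simp only [D.P_mul_P]
  · rw [← D.diag_P, D.absMul_spinedElt hd hp, D.st_P_e h, D.P_mul_P, D.P_mul_P]

theorem greenR_star (D : SpinedData jL jR TL TR st P Q) {e : L} {p q : G} {f : R}
    (h : Factorization jL jR e p q (Q q) f) :
    GreenROn (absMul TL TR st) (absTset TL TR) (spinedElt jL jR (jL (Q q)) (Q q) f)
      (jL (Q q), jR (Q q)) := by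
  have hs := D.factorization_star h
  have hd := D.factorization_diag_Q q
  refine ⟨.inr ⟨_, D.mem_absTset hs, ?_⟩, .inr ⟨_, D.diag_mem (Q q), ?_⟩⟩
  · rw [← D.diag_Q, D.absMul_spinedElt hd hs, D.st_mul]
    simp only [D.Q_mul_Q]
  · rw [← D.diag_Q, D.absMul_spinedElt hs hd, D.st_f_Q h, D.Q_mul_Q, D.Q_mul_Q]

theorem eq_of_greenL (D : SpinedData jL jR TL TR st P Q) {x : L × R} {s : G}
    (hx : x ∈ absTset TL TR) (hi : Idem (absMul TL TR st) x)
    (hL : GreenLOn (absMul TL TR st) (absTset TL TR) x (jL (P s), jR (P s))) :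
    ∃ e, e * jL (P s) = e ∧ jL (P s) * e = jL (P s) ∧
      x = spinedElt jL jR e (P s) (jR (P s)) := by
  obtain ⟨e, q, f, h, rfl⟩ := D.exists_factorization hx
  have hd := D.factorization_diag_P s
  have h1 := hL.mul_eq_left D.semigroupOn (D.diag_mem _)
    ((D.diag_idem_iff _).2 (D.P_mul_P s))
  have h2 := hL.symm.mul_eq_left D.semigroupOn hx hi
  rw [← D.diag_P, D.absMul_spinedElt h hd] at h1
  rw [← D.diag_P, D.absMul_spinedElt hd h] at h2
  obtain ⟨a1, -, a3⟩ := D.spinedElt_inj (h.mul hd) h h1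
  obtain ⟨b1, -, -⟩ := D.spinedElt_inj (hd.mul h) hd h2
  have hqP : q * P s = q := by rw [← a1, mul_assoc, D.P_mul_P]
  have hqq := D.idem_middle h hi
  have hPq : P s * q = P s := by
    calc P s * q = P s * st (jR (P s)) e * q * q := by rw [b1]
      _ = P s := by rw [mul_assoc, hqq, b1]
  have hq : q = P s := by rw [← hqP, D.comm hqq (D.P_mul_P s), hPq]
  rw [a1, h.mul_f, ← D.mapR, D.Q_of_idem hqq, hqP, hq] at a3
  have hP := D.P_of_idem hqq
  have he := h.e_mul
  have he' := h.mul_e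
  rw [hP, hq] at he he'
  exact ⟨e, he, he', by rw [hq, a3]⟩

theorem eq_of_greenR (D : SpinedData jL jR TL TR st P Q) {x : L × R} {s : G}
    (hx : x ∈ absTset TL TR) (hi : Idem (absMul TL TR st) x)
    (hR : GreenROn (absMul TL TR st) (absTset TL TR) x (jL (Q s), jR (Q s))) :
    ∃ f, jR (Q s) * f = f ∧ f * jR (Q s) = jR (Q s) ∧
      x = spinedElt jL jR (jL (Q s)) (Q s) f := by
  obtain ⟨e, q, f, h, rfl⟩ := D.exists_factorization hx
  have hd := D.factorization_diag_Q s
  have h1 := hR.mul_eq_right D.semigroupOn (D.diag_mem _)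
    ((D.diag_idem_iff _).2 (D.Q_mul_Q s))
  have h2 := hR.symm.mul_eq_right D.semigroupOn hx hi
  rw [← D.diag_Q, D.absMul_spinedElt hd h] at h1
  rw [← D.diag_Q, D.absMul_spinedElt h hd] at h2
  obtain ⟨a1, a2, -⟩ := D.spinedElt_inj (hd.mul h) h h1
  obtain ⟨b1, -, -⟩ := D.spinedElt_inj (h.mul hd) hd h2
  have hqq := D.idem_middle h hi
  have hQq : Q s * q = q := by rw [← a1, ← mul_assoc, ← mul_assoc, D.Q_mul_Q]
  have hqQ : q * Q s = Q s := by rw [← b1, ← mul_assoc, ← mul_assoc, hqq]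
  have hq : q = Q s := by rw [← hQq, ← D.comm hqq (D.Q_mul_Q s), hqQ]
  rw [a1, h.e_mul, ← D.mapL, D.P_of_idem hqq, hQq, hq] at a2
  have hQ := D.Q_of_idem hqq
  have hf := h.mul_f
  have hf' := h.f_mul
  rw [hQ, hq] at hf hf'
  exact ⟨f, hf, hf', by rw [hq, a2]⟩

/-- The diagonal copy of `S⁰` as an adequate transversal of the spined product. -/
def transversal (D : SpinedData jL jR TL TR st P Q) :
    AdequateTransversalOn (absMul TL TR st) (absTset TL TR) (absT0 jL jR) where
  sub := by
    rintro _ ⟨s, rfl⟩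
    exact D.diag_mem s
  mul_mem := by
    rintro _ ⟨s, rfl⟩ _ ⟨t, rfl⟩
    exact ⟨s * t, D.absMul_diag s t⟩
  bar x := (TL.bar x.1, TR.bar x.2)
  e x := (TL.e x.1, TR.plus (TR.bar x.2))
  f x := (TL.star (TL.bar x.1), TR.f x.2)
  plus x := (TL.plus x.1, TR.plus x.2)
  star x := (TL.star x.1, TR.star x.2)
  plus_mem := by
    rintro _ ⟨s, rfl⟩
    exact ⟨P s, Prod.ext (D.plusL s) (D.plusR s)⟩
  plus_idem := by
    rintro _ ⟨s, rfl⟩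
    rw [D.plusL, D.plusR, D.diag_idem_iff, D.P_mul_P]
  plus_rstar := by
    rintro _ ⟨s, rfl⟩
    have := D.rStarOn_plus (D.factorization_diag s)
    rwa [D.diag_P, D.spinedElt_diag, ← D.plusL, ← D.plusR] at this
  star_mem := by
    rintro _ ⟨s, rfl⟩
    exact ⟨Q s, Prod.ext (D.starL s) (D.starR s)⟩
  star_idem := by
    rintro _ ⟨s, rfl⟩
    rw [D.starL, D.starR, D.diag_idem_iff, D.Q_mul_Q]
  star_lstar := by
    rintro _ ⟨s, rfl⟩
    have := D.lStarOn_star (D.factorization_diag s)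
    rwa [D.diag_Q, D.spinedElt_diag, ← D.starL, ← D.starR] at this
  idem_comm := by
    rintro _ ⟨s, rfl⟩ _ ⟨t, rfl⟩ hs ht
    rw [D.diag_idem_iff] at hs ht
    rw [D.absMul_diag, D.absMul_diag, D.comm hs ht]
  bar_mem x hx := by
    obtain ⟨e, q, f, h, rfl⟩ := D.exists_factorization hx
    exact ⟨q, D.bar_spinedElt h⟩
  e_mem x hx := by
    obtain ⟨e, q, f, h, rfl⟩ := D.exists_factorization hx
    rw [D.e_spinedElt h]
    exact D.mem_absTset (D.factorization_plus h)
  f_mem x hx := by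
    obtain ⟨e, q, f, h, rfl⟩ := D.exists_factorization hx
    rw [D.f_spinedElt h]
    exact D.mem_absTset (D.factorization_star h)
  e_idem x hx := by
    obtain ⟨e, q, f, h, rfl⟩ := D.exists_factorization hx
    rw [D.e_spinedElt h]
    exact D.idem_plus h
  f_idem x hx := by
    obtain ⟨e, q, f, h, rfl⟩ := D.exists_factorization hx
    rw [D.f_spinedElt h]
    exact D.idem_star h
  decomp x hx := by
    obtain ⟨e, q, f, h, rfl⟩ := D.exists_factorization hx
    rw [D.e_spinedElt h, D.f_spinedElt h, D.bar_spinedElt h, D.decomp_spinedElt h]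
  e_greenL x hx := by
    obtain ⟨e, q, f, h, rfl⟩ := D.exists_factorization hx
    obtain ⟨h1, h2⟩ := Prod.ext_iff.1 (D.bar_spinedElt h)
    simp only at h1 h2
    rw [D.e_spinedElt h, h1, h2, D.plusL, D.plusR]
    exact D.greenL_plus h
  f_greenR x hx := by
    obtain ⟨e, q, f, h, rfl⟩ := D.exists_factorization hx
    obtain ⟨h1, h2⟩ := Prod.ext_iff.1 (D.bar_spinedElt h)
    simp only at h1 h2
    rw [D.f_spinedElt h, h1, h2, D.starL, D.starR]
    exact D.greenR_star h
  unique := by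
    rintro x - _ ⟨s, rfl⟩ e' he' f' hf' hei hfi hx hL hR
    rw [D.plusL, D.plusR] at hL
    rw [D.starL, D.starR] at hR
    obtain ⟨e, he1, he2, rfl⟩ := D.eq_of_greenL he' hei hL
    obtain ⟨f, hf1, hf2, rfl⟩ := D.eq_of_greenR hf' hfi hR
    have h : Factorization jL jR e (P s) s (Q s) f :=
      ⟨he1, he2, D.P_mul s, D.mul_Q s, hf1, hf2⟩
    rw [D.decomp_spinedElt h] at hx
    subst hx
    exact ⟨(D.bar_spinedElt h).symm, (D.e_spinedElt h).symm, (D.f_spinedElt h).symm⟩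

theorem transversal_isMultiplicative (D : SpinedData jL jR TL TR st P Q) :
    D.transversal.IsMultiplicative := by
  rintro _ ⟨x, hx, rfl⟩ _ ⟨y, hy, rfl⟩
  obtain ⟨e, q, f, h, rfl⟩ := D.exists_factorization hx
  obtain ⟨e', q', f', h', rfl⟩ := D.exists_factorization hy
  have hee : e' * e' = e' := by
    calc e' * e' = e' * jL (P q') * e' := by rw [h'.e_mul]
      _ = e' := by rw [mul_assoc, h'.mul_e, h'.e_mul]
  have hff : f * f = f := by
    calc f * f = f * (jR (Q q) * f) := by rw [h.mul_f]
      _ = f := by rw [← mul_assoc, h.f_mul, h.mul_f]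
  have h1 : Q q * st f e' = st f e' := by rw [← D.smul_st, h.mul_f]
  have h2 : st f e' * P q' = st f e' := by rw [← D.st_smul, h'.e_mul]
  have key : absMul TL TR st (D.transversal.f (spinedElt jL jR e q f))
      (D.transversal.e (spinedElt jL jR e' q' f')) = (jL (st f e'), jR (st f e')) := by
    simp only [transversal]
    rw [D.f_spinedElt h, D.e_spinedElt h',
      D.absMul_spinedElt (D.factorization_star h) (D.factorization_plus h'), h1, h2, spinedElt,
      ← D.mapL, ← D.mapR, h1, h2]
  rw [key, D.diag_idem_iff]
  exact ⟨⟨_, rfl⟩, D.st_idem f e' hff hee⟩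

end SpinedData

theorem exists_plus {jL : G → L} {jR : G → R}
    (hjL : Function.Injective jL) (hjR : Function.Injective jR)
    (hjLm : ∀ s t : G, jL (s * t) = jL s * jL t)
    (hjRm : ∀ s t : G, jR (s * t) = jR s * jR t)
    (TL : AdequateTransversalOn (mulOf L) Set.univ (Set.range jL))
    (TR : AdequateTransversalOn (mulOf R) Set.univ (Set.range jR)) (s : G) :
    ∃ p, TL.plus (jL s) = jL p ∧ TR.plus (jR s) = jR p := by
  obtain ⟨p, hp⟩ := TL.plus_mem (jL s) ⟨s, rfl⟩
  obtain ⟨p', hp'⟩ := TR.plus_mem (jR s) ⟨s, rfl⟩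
  have h1 := TL.plus_mul (s := jL s) ⟨s, rfl⟩
  have h2 := TR.plus_mul (s := jR s) ⟨s, rfl⟩
  have i1 := TL.plus_mul_plus (s := jL s) ⟨s, rfl⟩
  have i2 := TR.plus_mul_plus (s := jR s) ⟨s, rfl⟩
  rw [← hp, ← hjLm] at h1 i1
  rw [← hp', ← hjRm] at h2 i2
  have h3 := TL.mul_plus_of_mul (s := jL s) (x := jL p') ⟨s, rfl⟩ (by rw [← hjLm, hjR h2])
  have h4 := TR.mul_plus_of_mul (s := jR s) (x := jR p) ⟨s, rfl⟩ (by rw [← hjRm, hjL h1])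
  have h5 : jL p * jL p' = jL p' * jL p := TL.idem_comm _ ⟨p, rfl⟩ _ ⟨p', rfl⟩
    (by rw [Idem, mulOf, ← hjLm, i1]) (by rw [Idem, mulOf, ← hjLm, hjR i2])
  rw [← hp, ← h5, ← hjLm] at h3
  rw [← hp', ← hjRm] at h4
  have : p = p' := (hjL h3).symm.trans (hjR h4)
  exact ⟨p, hp.symm, by rw [← hp', this]⟩

theorem exists_star {jL : G → L} {jR : G → R}
    (hjL : Function.Injective jL) (hjR : Function.Injective jR)
    (hjLm : ∀ s t : G, jL (s * t) = jL s * jL t)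
    (hjRm : ∀ s t : G, jR (s * t) = jR s * jR t)
    (TL : AdequateTransversalOn (mulOf L) Set.univ (Set.range jL))
    (TR : AdequateTransversalOn (mulOf R) Set.univ (Set.range jR)) (s : G) :
    ∃ p, TL.star (jL s) = jL p ∧ TR.star (jR s) = jR p := by
  obtain ⟨p, hp⟩ := TL.star_mem (jL s) ⟨s, rfl⟩
  obtain ⟨p', hp'⟩ := TR.star_mem (jR s) ⟨s, rfl⟩
  have h1 := TL.mul_star (s := jL s) ⟨s, rfl⟩
  have h2 := TR.mul_star (s := jR s) ⟨s, rfl⟩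
  have i1 := TL.star_mul_star (s := jL s) ⟨s, rfl⟩
  have i2 := TR.star_mul_star (s := jR s) ⟨s, rfl⟩
  rw [← hp, ← hjLm] at h1 i1
  rw [← hp', ← hjRm] at h2 i2
  have h3 := TL.star_mul_of_mul (s := jL s) (x := jL p') ⟨s, rfl⟩ (by rw [← hjLm, hjR h2])
  have h4 := TR.star_mul_of_mul (s := jR s) (x := jR p) ⟨s, rfl⟩ (by rw [← hjRm, hjL h1])
  have h5 : jL p * jL p' = jL p' * jL p := TL.idem_comm _ ⟨p, rfl⟩ _ ⟨p', rfl⟩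
    (by rw [Idem, mulOf, ← hjLm, i1]) (by rw [Idem, mulOf, ← hjLm, hjR i2])
  rw [← hp, h5, ← hjLm] at h3
  rw [← hp', ← hjRm] at h4
  have : p = p' := (hjL h3).symm.trans (hjR h4)
  exact ⟨p, hp.symm, by rw [← hp', this]⟩

theorem exists_spinedData {jL : G → L} {jR : G → R}
    (hjL : Function.Injective jL) (hjR : Function.Injective jR)
    (hjLm : ∀ s t : G, jL (s * t) = jL s * jL t)
    (hjRm : ∀ s t : G, jR (s * t) = jR s * jR t)
    (hL : LeftAdequateOn (mulOf L) Set.univ) (hR : RightAdequateOn (mulOf R) Set.univ)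
    (TL : AdequateTransversalOn (mulOf L) Set.univ (Set.range jL))
    (TR : AdequateTransversalOn (mulOf R) Set.univ (Set.range jR))
    {st : R → L → G}
    (hassoc : ∀ (y z : L) (a b : R), (∃ s : G, jL s = TL.bar y ∧ jR s = TR.bar b) →
      st (jR (st a y) * TR.f b) z = st a (TL.e y * jL (st b z)))
    (hstL : ∀ (s : G) (x : L), jL (st (jR s) x) = jL s * x)
    (hstR : ∀ (a : R) (s : G), jR (st a (jL s)) = a * jR s)
    (hidem : ∀ (e : R) (f : L), Idem (mulOf R) e → Idem (mulOf L) f →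
      Idem (mulOf G) (st e f)) :
    ∃ P Q, SpinedData jL jR TL TR st P Q := by
  choose P hPL hPR using exists_plus hjL hjR hjLm hjRm TL TR
  choose Q hQL hQR using exists_star hjL hjR hjLm hjRm TL TR
  have hst (g h : G) : st (jR g) (jL h) = g * h := hjL (by rw [hstL, hjLm])
  have P_mul_P (s : G) : P s * P s = P s :=
    hjL (by rw [hjLm, ← hPL, TL.plus_mul_plus ⟨s, rfl⟩])
  have Q_mul_Q (s : G) : Q s * Q s = Q s :=
    hjL (by rw [hjLm, ← hQL, TL.star_mul_star ⟨s, rfl⟩])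
  have P_mul (s : G) : P s * s = s := hjL (by rw [hjLm, ← hPL, TL.plus_mul ⟨s, rfl⟩])
  have mul_Q (s : G) : s * Q s = s := hjL (by rw [hjLm, ← hQL, TL.mul_star ⟨s, rfl⟩])
  have smul_aux (g : G) (b : R) (z : L) {t : G} (ht : jR t = TR.bar b) :
      st (jR g * b) z = g * P t * st b z := by
    have hm : jL t ∈ Set.range jL := ⟨t, rfl⟩
    have h := hassoc (jL t) z (jR g) b ⟨t, (TL.factors_of_mem hm).1.symm, ht⟩
    have hb : jR t * TR.f b = b := by
      have := TR.e_mul_bar_mul_f b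
      rwa [TR.e_eq_plus_of_rightAdequate hR, TR.plus_mul (TR.bar_mem b trivial), ← ht] at this
    rwa [hst, hjRm, mul_assoc, hb, (TL.factors_of_mem hm).2.1, hPL, ← hjLm, hst,
      ← mul_assoc] at h
  have st_aux (a : R) (y : L) (g : G) {t : G} (ht : jL t = TL.bar y) :
      st a (y * jL g) = st a y * Q t * g := by
    have hm : jR t ∈ Set.range jR := ⟨t, rfl⟩
    have h := hassoc y (jL g) a (jR t) ⟨t, ht, (TR.factors_of_mem hm).1.symm⟩
    have hy : TL.e y * jL t = y := by
      have := TL.e_mul_bar_mul_f y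
      rwa [TL.f_eq_star_of_leftAdequate hL, mul_assoc, TL.mul_star (TL.bar_mem y trivial),
        ← ht] at this
    rw [hst, hjLm, ← mul_assoc, hy, (TR.factors_of_mem hm).2.2, hQR, ← hjRm, hst] at h
    exact h.symm
  refine ⟨P, Q, hjL, hjR, hjLm, hjRm, hPL, hPR, hQL, hQR, TL.f_eq_star_of_leftAdequate hL,
    TR.e_eq_plus_of_rightAdequate hR, fun g b z => ?_, fun b z g => ?_, hstL, hstR,
    fun e f he hf => hidem e f he hf⟩
  · obtain ⟨t, ht⟩ := TR.bar_mem b trivial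
    have hb : jR (P t) * b = b := by
      have := TR.e_mul_bar_mul_f b
      rw [TR.e_eq_plus_of_rightAdequate hR, TR.plus_mul (TR.bar_mem b trivial), ← ht] at this
      rw [← this, ← mul_assoc, ← hjRm, P_mul]
    have h := smul_aux (P t) b z ht
    rw [hb, P_mul_P] at h
    rw [smul_aux g b z ht, mul_assoc, ← h]
  · obtain ⟨t, ht⟩ := TL.bar_mem z trivial
    have hz : z * jL (Q t) = z := by
      have := TL.e_mul_bar_mul_f z
      rw [TL.f_eq_star_of_leftAdequate hL, mul_assoc, TL.mul_star (TL.bar_mem z trivial),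
        ← ht] at this
      rw [← this, mul_assoc, ← hjLm, mul_Q]
    have h := st_aux b z (Q t) ht
    rw [hz, mul_assoc, Q_mul_Q] at h
    rw [st_aux b z g ht, ← h]

end SpinedProduct

end Paper

open Paper in
/-- **Theorem `multiplicative-theorem`.** With hypotheses as in
the main theorem plus (3) `e∗f ∈ E⁰` for `e ∈ E(R)`, `f ∈ E(L)`, the spined
product `T` is an abundant semigroup with `T⁰ = {(s,s)}` a *multiplicative*
adequate transversal isomorphic to `S⁰`.  Conversely, every multiplicative
adequate transversal of an abundant semigroup `S` arises this way: with
`a∗x = ax` conditions (1)–(3) hold and `S ≅ T` via `φ`. -/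
theorem stmt15 {L R G : Type u} [Semigroup L] [Semigroup R] [Semigroup G]
    (jL : G → L) (jR : G → R)
    (hjL : Function.Injective jL) (hjR : Function.Injective jR)
    (hjLm : ∀ s t : G, jL (s * t) = jL s * jL t)
    (hjRm : ∀ s t : G, jR (s * t) = jR s * jR t)
    (hG : AdequateOn (mulOf G) Set.univ)
    (hL : LeftAdequateOn (mulOf L) Set.univ)
    (hR : RightAdequateOn (mulOf R) Set.univ)
    (TL : AdequateTransversalOn (mulOf L) Set.univ (Set.range jL))
    (TR : AdequateTransversalOn (mulOf R) Set.univ (Set.range jR))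
    (hQL : QuasiIdealOn (mulOf L) Set.univ (Set.range jL))
    (hQR : QuasiIdealOn (mulOf R) Set.univ (Set.range jR))
    (st : R → L → G)
    (cond1 : ∀ (y z : L) (a b : R),
      (∃ s : G, jL s = TL.bar y ∧ jR s = TR.bar b) →
      st (jR (st a y) * TR.f b) z = st a (TL.e y * jL (st b z)))
    (cond2L : ∀ (s : G) (x : L), jL (st (jR s) x) = jL s * x)
    (cond2R : ∀ (a : R) (s : G), jR (st a (jL s)) = a * jR s)
    (cond3 : ∀ (e : R) (f : L), Idem (mulOf R) e → Idem (mulOf L) f →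
      Idem (mulOf G) (st e f)) :
    (SemigroupOn (absMul TL TR st) (absTset TL TR) ∧
     AbundantOn (absMul TL TR st) (absTset TL TR) ∧
     (∃ T' : AdequateTransversalOn (absMul TL TR st) (absTset TL TR) (absT0 jL jR),
        T'.IsMultiplicative) ∧
     IsoOn (mulOf G) (absMul TL TR st) Set.univ (absT0 jL jR)) ∧
    (∀ (S : Type u) [Semigroup S] (S0 : Set S)
       (T : AdequateTransversalOn (mulOf S) Set.univ S0),
       AbundantOn (mulOf S) Set.univ → T.IsMultiplicative →
       ((∀ y ∈ T.Lset, ∀ z ∈ T.Lset, ∀ a ∈ T.Rset, ∀ b ∈ T.Rset,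
           T.bar y = T.bar b → a * y * T.f b * z = a * (T.e y * (b * z))) ∧
        (∀ a ∈ T.Rset, ∀ x ∈ T.Lset, a * x ∈ S0) ∧
        (∀ e ∈ T.Rset, ∀ f ∈ T.Lset, Idem (mulOf S) e → Idem (mulOf S) f →
           e * f ∈ S0 ∧ Idem (mulOf S) (e * f)) ∧
        Set.BijOn (phiMap T) Set.univ (spSet T) ∧
        (∀ x y : S, phiMap T (x * y) = spMul T (phiMap T x) (phiMap T y)))) := by
  refine ⟨?_, fun S _ S0 T _ hT => ⟨?_, ?_, ?_, T.phiMap_bijOn, hT.phiMap_mul⟩⟩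
  · obtain ⟨P, Q, D⟩ :=
      exists_spinedData hjL hjR hjLm hjRm hL hR TL TR cond1 cond2L cond2R cond3
    exact ⟨D.semigroupOn, D.abundantOn, ⟨D.transversal, D.transversal_isMultiplicative⟩,
      D.isoOn⟩
  · intro y hy z _ a _ b hb hyb
    calc a * y * T.f b * z = a * (T.e y * T.bar y) * T.f b * z := by rw [T.eq_e_mul_bar hy]
      _ = a * (T.e y * ((T.bar b * T.f b) * z)) := by rw [hyb]; simp only [mul_assoc]
      _ = a * (T.e y * (b * z)) := by rw [T.eq_bar_mul_f hb]
  · intro a ha x hx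
    rw [← T.eq_bar_mul_f ha, ← T.eq_e_mul_bar hx]
    exact hT.bar_mul_f_mul_e_mul_bar_mem a x
  · intro e he f hf hee hff
    rw [← hT.eq_f_of_idem he hee, ← hT.eq_e_of_idem hf hff]
    exact ⟨hT.f_mul_e_mem e f, hT.f_mul_e_idem e f⟩
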